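/- arXiv:1512.04637 — 2 statements merged into one kernel-verified Lean document; each statement's English description precedes it below -/
import Mathlib

section
/- Let M be an exchange mechanism on {1,…,m} satisfying Anonymity, Aggregation, Invariance and Non-dissipation, with extended net-trade function ν. Then M admits no arbitrage: for every (a,b) ∈ S × S₊, the vector ν(a,b) is neither ≥ 0 with some strictly positive component nor ≤ 0 with some strictly negative component; equivalently, if ν(a,b) ≥ 0 componentwise or ν(a,b) ≤ 0 componentwise, then ν(a,b) = 0. -/
open Finset

/-- An (abstract) exchange mechanism on the commodity set `{1,…,m}` (modelled as `Fin m`):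
a finite index set `K = K₁ ⊔ ⋯ ⊔ K_m` (an index `h` belongs to `K_i` iff `ind h = i`),
together with, for every number `n` of traders, a return map `rho n`. -/
structure ExchangeMechanism (m : ℕ) where
  K : Type
  fintypeK : Fintype K
  decEqK : DecidableEq K
  ind : K → Fin m
  rho : (n : ℕ) → (Fin n → K → ℝ) → Fin n → Fin m → ℝ

namespace ExchangeMechanism

variable {m : ℕ} (M : ExchangeMechanism m)

instance : Fintype M.K := M.fintypeK
instance : DecidableEq M.K := M.decEqK

/-- `a ∈ S = ℝ₊^K`. -/
def Nonneg (a : M.K → ℝ) : Prop := ∀ h, 0 ≤ a h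

/-- `b ∈ S₊ = ℝ₊₊^K`. -/
def Pos (b : M.K → ℝ) : Prop := ∀ h, 0 < b h

/-- `(a¹,…,aⁿ) ∈ S(n)`: an admissible tuple of offers (nonnegative, positive in aggregate). -/
def Valid (n : ℕ) (a : Fin n → M.K → ℝ) : Prop :=
  (∀ k, M.Nonneg (a k)) ∧ M.Pos (∑ k, a k)

/-- The aggregate `ā ∈ C = ℝ₊^m` of an offer `a`, `ā_i = Σ_{h ∈ K_i} a_h`. -/
def agg (a : M.K → ℝ) : Fin m → ℝ :=
  fun i => ∑ h ∈ Finset.univ.filter (fun h => M.ind h = i), a h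

/-- Conservation of commodities: everything received is redistributed. -/
def Conserves : Prop :=
  ∀ n (a : Fin n → M.K → ℝ), M.Valid n a →
    ∑ k, M.rho n a k = ∑ k, M.agg (a k)

/-- Anonymity. -/
def Anonymous : Prop :=
  ∀ n (a : Fin n → M.K → ℝ) (σ : Equiv.Perm (Fin n)), M.Valid n a →
    M.rho n (a ∘ σ) = (M.rho n a) ∘ σ

/-- Aggregation: merging the last two offers merges the last two returns. -/
def Aggregative : Prop :=
  ∀ n (a : Fin (n + 2) → M.K → ℝ), M.Valid (n + 2) a →
    M.rho (n + 1)
      (Fin.snoc (fun k : Fin n => a k.castSucc.castSucc)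
        (a (Fin.castSucc (Fin.last n)) + a (Fin.last (n + 1)))) =
      Fin.snoc (fun k : Fin n => M.rho (n + 2) a k.castSucc.castSucc)
        (M.rho (n + 2) a (Fin.castSucc (Fin.last n)) + M.rho (n + 2) a (Fin.last (n + 1)))

/-- The scaling action `(λ ∗ a)_h = λ_{i} a_h` for `h ∈ K_i` on offers. -/
def scaleS (lam : Fin m → ℝ) (a : M.K → ℝ) : M.K → ℝ := fun h => lam (M.ind h) * a h

/-- Invariance under change of units. -/
def Invariant : Prop :=
  ∀ n (a : Fin n → M.K → ℝ) (lam : Fin m → ℝ), (∀ i, 0 < lam i) → M.Valid n a →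
    M.rho n (fun k => M.scaleS lam (a k)) = fun k i => lam i * M.rho n a k i

/-- Non-dissipation: each net return `rᵏ − āᵏ` is `0` or has a strictly positive component. -/
def NonDissipative : Prop :=
  ∀ n (a : Fin n → M.K → ℝ), M.Valid n a → ∀ k,
    M.rho n a k = M.agg (a k) ∨ ∃ i, M.agg (a k) i < M.rho n a k i

/-- The two-trader return `ρ(a, b)`: the first component of `ρ²`. -/
def ret (a b : M.K → ℝ) : Fin m → ℝ := M.rho 2 ![a, b] 0

/-- The unit offer `e_h`. -/
def unit (h : M.K) : M.K → ℝ := Pi.single h 1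

/-- `h ∈ K_i` is an `ij`-index: some offer of the others yields a positive return of `j`. -/
def IsIJIndex (i j : Fin m) (h : M.K) : Prop :=
  M.ind h = i ∧ ∃ a, M.Valid 2 ![M.unit h, a] ∧ 0 < M.ret (M.unit h) a j

/-- A pure `ij`-index: the return to `e_h` is always exclusively in commodity `j`. -/
def IsPureIJIndex (i j : Fin m) (h : M.K) : Prop :=
  M.IsIJIndex i j h ∧
    ∀ a, M.Valid 2 ![M.unit h, a] → ∀ k, k ≠ j → M.ret (M.unit h) a k = 0

/-- Flexibility: whenever there is an `ij`-index there is a pure `ij`-index. -/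
def Flexible : Prop :=
  ∀ i j : Fin m, (∃ h, M.IsIJIndex i j h) → ∃ h, M.IsPureIJIndex i j h

/-- The trade function `r(a,b) = ρ(a, b − a)` (for `a ≤ b`, `b ∈ S₊`). -/
def trade (a b : M.K → ℝ) : Fin m → ℝ := M.ret a (b - a)

/-- The net-trade function `ν(a,b) = r(a,b) − ā` (for `a ≤ b`, `b ∈ S₊`). -/
def nu (a b : M.K → ℝ) : Fin m → ℝ := M.trade a b - M.agg a

/-- `nu'` is an extension of the net-trade function `ν` to all of `S × S₊` which is
homogeneous of degree 1 in the offer and of degree 0 in the market state. -/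
def IsNuExtension (nu' : (M.K → ℝ) → (M.K → ℝ) → Fin m → ℝ) : Prop :=
  (∀ a b, M.Nonneg a → M.Pos b → a ≤ b → nu' a b = M.nu a b) ∧
  (∀ a b (t : ℝ), M.Nonneg a → M.Pos b → 0 < t → nu' (t • a) b = t • nu' a b) ∧
  (∀ a b (t : ℝ), M.Nonneg a → M.Pos b → 0 < t → nu' a (t • b) = nu' a b)

end ExchangeMechanism

namespace ExchangeMechanism

/-- Every offer can be scaled down to fit into a given positive market state. -/
theorem exists_pos_smul_le {m : ℕ} (M : ExchangeMechanism m) {a b : M.K → ℝ}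
    (ha : M.Nonneg a) (hb : M.Pos b) : ∃ t : ℝ, 0 < t ∧ t • a ≤ b := by
  have hq : ∀ h, 0 ≤ a h / b h := fun h => div_nonneg (ha h) (hb h).le
  have hs : 0 < 1 + ∑ h, a h / b h :=
    add_pos_of_pos_of_nonneg one_pos (Finset.sum_nonneg fun h _ => hq h)
  refine ⟨(1 + ∑ h, a h / b h)⁻¹, inv_pos.mpr hs, fun h => ?_⟩
  have hle : a h / b h ≤ 1 + ∑ h, a h / b h :=
    (Finset.single_le_sum (f := fun h => a h / b h) (fun h _ => hq h)
      (Finset.mem_univ h)).trans (le_add_of_nonneg_left zero_le_one)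
  rw [Pi.smul_apply, smul_eq_mul, inv_mul_le_iff₀ hs]
  exact (div_le_iff₀ (hb h)).mp hle

theorem valid_pair {m : ℕ} (M : ExchangeMechanism m) {a b : M.K → ℝ}
    (ha : M.Nonneg a) (hb : M.Pos b) (hab : a ≤ b) : M.Valid 2 ![a, b - a] := by
  refine ⟨Fin.forall_fin_two.mpr ⟨ha, fun h => sub_nonneg.mpr (hab h)⟩, ?_⟩
  simpa [Fin.sum_univ_two] using hb

/-- A net trade of constant sign vanishes: non-dissipation applies to the trader if the
net trade is nonpositive, and to the rest of the market if it is nonnegative. -/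
theorem nu_eq_zero_of_sign {m : ℕ} (M : ExchangeMechanism m)
    (hcons : M.Conserves) (hnd : M.NonDissipative) {a b : M.K → ℝ}
    (ha : M.Nonneg a) (hb : M.Pos b) (hab : a ≤ b)
    (hsign : (∀ i, 0 ≤ M.nu a b i) ∨ (∀ i, M.nu a b i ≤ 0)) : M.nu a b = 0 := by
  have hv := M.valid_pair ha hb hab
  have hc : ∀ i, M.nu a b i +
      (M.rho 2 ![a, b - a] 1 i - M.agg (b - a) i) = 0 := fun i => by
    have h := congrFun (hcons 2 _ hv) i
    simp only [Fin.sum_univ_two, Pi.add_apply, Matrix.cons_val_zero, Matrix.cons_val_one] at h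
    simp only [nu, trade, ret, Pi.sub_apply]
    linarith
  rcases hsign with hs | hs
  · rcases hnd 2 _ hv 1 with h | ⟨i, hi⟩
    · funext i
      have := congrFun h i
      have := hc i
      simp_all
    · have := hc i
      have := hs i
      simp only [Matrix.cons_val_one, Matrix.cons_val_zero] at hi
      linarith
  · rcases hnd 2 _ hv 0 with h | ⟨i, hi⟩
    · exact sub_eq_zero.mpr h
    · exact absurd (hs i) (not_le.mpr (sub_pos.mpr hi))

end ExchangeMechanism

/-- No arbitrage.  Let `M` be an exchange mechanism satisfying Anonymity,
Aggregation, Invariance and Non-dissipation, with extended net-trade function `ν`.  Then for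
every `(a,b) ∈ S × S₊`: if `ν(a,b) ≥ 0` componentwise or `ν(a,b) ≤ 0` componentwise, then
`ν(a,b) = 0` (equivalently, `ν(a,b)` is neither `≩ 0` nor `≨ 0`). -/
theorem no_arbitrage {m : ℕ} (M : ExchangeMechanism m)
    (hcons : M.Conserves) (hanon : M.Anonymous) (hagg : M.Aggregative)
    (hinv : M.Invariant) (hnd : M.NonDissipative)
    (nu' : (M.K → ℝ) → (M.K → ℝ) → Fin m → ℝ) (hext : M.IsNuExtension nu') :
    ∀ a b, M.Nonneg a → M.Pos b →
      ((∀ i, 0 ≤ nu' a b i) ∨ (∀ i, nu' a b i ≤ 0)) → nu' a b = 0 := by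
  intro a b ha hb hsign
  obtain ⟨heq, hsmul, -⟩ := hext
  obtain ⟨t, ht, hle⟩ := M.exists_pos_smul_le ha hb
  have hta : M.Nonneg (t • a) := fun h => mul_nonneg ht.le (ha h)
  have hν : M.nu (t • a) b = t • nu' a b :=
    (heq _ _ hta hb hle).symm.trans (hsmul a b t ha hb ht)
  have hzero : M.nu (t • a) b = 0 := by
    refine M.nu_eq_zero_of_sign hcons hnd hta hb hle ?_
    rw [hν]
    exact hsign.imp (fun h i => mul_nonneg ht.le (h i))
      (fun h i => mul_nonpos_of_nonneg_of_nonpos ht.le (h i))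
  exact (smul_eq_zero.mp (hν.symm.trans hzero)).resolve_left ht.ne'
end

section
/- For m > 3, each of the star, cycle and complete mechanisms is ⪯-minimal in 𝔐_g(m): no G-mechanism M′ satisfies M′ ⪯ M and M′ ≠ M (up to relabeling) for M one of these three. In particular: any G-mechanism whose graph is not complete has some τ_ij > 1; any G-mechanism whose graph is not the cycle has some k_i > 1; and any G-mechanism whose graph is not the star has either some π_ij ≥ 5 or some τ_ij ≥ 3. -/
open Finset
open scoped Classical

/-! ### Graphical mechanisms: directed graphs on `Fin m` and their complexities -/

/-- `G` has no loops. -/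
def GIrrefl {m : ℕ} (G : Fin m → Fin m → Prop) : Prop := ∀ i, ¬ G i i

/-- `G` is connected: for any two distinct vertices there is a directed path. -/
def GConnected {m : ℕ} (G : Fin m → Fin m → Prop) : Prop :=
  ∀ i j : Fin m, i ≠ j → Relation.TransGen G i j

/-- A connected directed graph without loops (the data defining a `G`-mechanism). -/
def GOK {m : ℕ} (G : Fin m → Fin m → Prop) : Prop := GIrrefl G ∧ GConnected G

/-- `a ∈ S = ℝ₊^{E_G}`: a nonnegative offer matrix supported on the edges of `G`. -/
def GNonneg {m : ℕ} (G : Fin m → Fin m → Prop) (a : Fin m → Fin m → ℝ) : Prop :=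
  ∀ i j, 0 ≤ a i j ∧ (¬ G i j → a i j = 0)

/-- `b ∈ S₊ = ℝ₊₊^{E_G}`: a matrix positive on the edges of `G` and zero off them. -/
def GPos {m : ℕ} (G : Fin m → Fin m → Prop) (b : Fin m → Fin m → ℝ) : Prop :=
  ∀ i j, (G i j → 0 < b i j) ∧ (¬ G i j → b i j = 0)

/-- `p` is a price vector for the market state `b` of the `G`-mechanism:
strictly positive and balancing values, `Σ_i p_i·b_ij = Σ_i p_j·b_ji` for all `j`. -/
def GPriceProp {m : ℕ} (b : Fin m → Fin m → ℝ) (p : Fin m → ℝ) : Prop :=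
  (∀ i, 0 < p i) ∧ ∀ j, ∑ i, p i * b i j = ∑ i, p j * b j i

/-- The price vector of the `G`-mechanism at market state `b` (a canonical choice;
for connected `G` and `b ∈ S₊` it exists and is unique up to positive scaling). -/
noncomputable def GPrice {m : ℕ} (b : Fin m → Fin m → ℝ) : Fin m → ℝ :=
  if h : ∃ p, GPriceProp b p then h.choose else fun _ => 1

/-- The aggregate `ā_i = Σ_j a_ij` of an offer matrix. -/
def GAgg {m : ℕ} (a : Fin m → Fin m → ℝ) : Fin m → ℝ := fun i => ∑ j, a i j

/-- The return function of the `G`-mechanism: `r_i(a,b) = p_i(b)⁻¹·Σ_j p_j(b)·a_ji`. -/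
noncomputable def GRet {m : ℕ} (a b : Fin m → Fin m → ℝ) : Fin m → ℝ :=
  fun i => (GPrice b i)⁻¹ * ∑ j, GPrice b j * a j i

/-- The net-trade function `ν(a,b) = r(a,b) − ā` of the `G`-mechanism. -/
noncomputable def GNu {m : ℕ} (a b : Fin m → Fin m → ℝ) : Fin m → ℝ :=
  fun i => GRet a b i - GAgg a i

/-- `v → w` in the `G`-mechanism. -/
def GConverts {m : ℕ} (G : Fin m → Fin m → Prop) (v w : Fin m → ℝ) : Prop :=
  ∃ a b, GNonneg G a ∧ GPos G b ∧ GAgg a ≤ v ∧ w = v + GNu a b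

/-- `v` converts to `w` in exactly `t` steps in the `G`-mechanism. -/
def GConvertsIn {m : ℕ} (G : Fin m → Fin m → Prop) (t : ℕ) (v w : Fin m → ℝ) : Prop :=
  ∃ f : Fin (t + 1) → Fin m → ℝ, f 0 = v ∧ f (Fin.last t) = w ∧
    ∀ k : Fin t, GConverts G (f k.castSucc) (f k.succ)

/-- The time complexity `τ_ij` of the `G`-mechanism: the least number of conversion
steps from `e_i` to `e_j`. -/
noncomputable def GTau {m : ℕ} (G : Fin m → Fin m → Prop) (i j : Fin m) : ℕ :=
  sInf {t : ℕ | GConvertsIn G t (Pi.single i 1) (Pi.single j 1)}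

/-- The index complexity `k_i` of the `G`-mechanism: the number of outgoing edges at `i`. -/
noncomputable def GKcx {m : ℕ} (G : Fin m → Fin m → Prop) (i : Fin m) : ℕ :=
  Set.ncard {j : Fin m | G i j}

/-- The edge-component `e` is influential for the price-ratio function
`p_ij : S₊ → ℝ` of the `G`-mechanism. -/
def GInfluential {m : ℕ} (G : Fin m → Fin m → Prop) (i j : Fin m)
    (e : Fin m × Fin m) : Prop :=
  ∃ x y, GPos G x ∧ GPos G y ∧ (∀ k l, (k, l) ≠ e → x k l = y k l) ∧
    GPrice x i / GPrice x j ≠ GPrice y i / GPrice y j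

/-- The price complexity `π_ij` of the `G`-mechanism: the number of influential
components of the price-ratio function `p_ij`. -/
noncomputable def GPi {m : ℕ} (G : Fin m → Fin m → Prop) (i j : Fin m) : ℕ :=
  Set.ncard {e : Fin m × Fin m | GInfluential G i j e}

/-- The worst-case time complexity `τ = max_{i≠j} τ_ij` of the `G`-mechanism. -/
noncomputable def GTauMax {m : ℕ} (G : Fin m → Fin m → Prop) : ℕ :=
  Finset.sup Finset.univ.offDiag fun e : Fin m × Fin m => GTau G e.1 e.2

/-- The worst-case price complexity `π = max_{i≠j} π_ij` of the `G`-mechanism. -/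
noncomputable def GPiMax {m : ℕ} (G : Fin m → Fin m → Prop) : ℕ :=
  Finset.sup Finset.univ.offDiag fun e : Fin m × Fin m => GPi G e.1 e.2

/-- `M_{G'} ⪯ M_G`: the `G'`-mechanism is no more complex than the `G`-mechanism. -/
def GLe {m : ℕ} (G' G : Fin m → Fin m → Prop) : Prop :=
  (∀ i j : Fin m, i ≠ j → GTau G' i j ≤ GTau G i j ∧ GPi G' i j ≤ GPi G i j) ∧
    ∀ i, GKcx G' i ≤ GKcx G i

/-- The graphs `G` and `G'` differ by a relabeling of commodities. -/
def GraphIso {m : ℕ} (G G' : Fin m → Fin m → Prop) : Prop :=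
  ∃ σ : Equiv.Perm (Fin m), ∀ i j, G i j ↔ G' (σ i) (σ j)

/-- The star graph with center (money) `c`: edges `{ci, ic : i ≠ c}`. -/
def starGraph (m : ℕ) (c : Fin m) : Fin m → Fin m → Prop :=
  fun i j => i ≠ j ∧ (i = c ∨ j = c)

/-- The cycle graph: edges `{12, 23, …, (m−1)m, m1}`. -/
def cycleGraph (m : ℕ) : Fin m → Fin m → Prop :=
  fun i j => (j : ℕ) = ((i : ℕ) + 1) % m

/-- The complete graph: edges `{ij : i ≠ j}`. -/
def completeDigraph (m : ℕ) : Fin m → Fin m → Prop := fun i j => i ≠ j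

section Prices

variable {m : ℕ} {G : Fin m → Fin m → Prop}

lemma GPos.nonneg {b : Fin m → Fin m → ℝ} (hb : GPos G b) (i j : Fin m) : 0 ≤ b i j := by
  by_cases h : G i j
  · exact ((hb i j).1 h).le
  · exact ((hb i j).2 h).ge

/-- A property that spreads along edges of a connected graph holds everywhere once it holds
somewhere. -/
lemma GConnected.forall_of_edge (hG : GConnected G) {P : Fin m → Prop}
    (hP : ∀ i j, G i j → P i → P j) {i : Fin m} (hi : P i) (j : Fin m) : P j := by
  by_cases hij : i = j
  · exact hij ▸ hi
  · have h := hG i j hij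
    induction h with
    | single h => exact hP _ _ h hi
    | @tail y z _ h ih =>
      by_cases hy : i = y
      · exact hP _ _ h (hy ▸ hi)
      · exact hP _ _ h (ih hy)

/-- Prices exist at every market state of a connected graph. -/
lemma exists_price (hG : GConnected G) {b : Fin m → Fin m → ℝ} (hb : GPos G b) :
    ∃ p, GPriceProp b p := by
  rcases isEmpty_or_nonempty (Fin m) with hm | hm
  · exact ⟨fun _ => 1, fun i => hm.elim i, fun i => hm.elim i⟩
  let L : Matrix (Fin m) (Fin m) ℝ := fun i j => b i j - if i = j then ∑ k, b j k else 0
  have hL : ∃ u, u ≠ 0 ∧ Matrix.vecMul u L = 0 := by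
    rw [Matrix.exists_vecMul_eq_zero_iff, ← Matrix.exists_mulVec_eq_zero_iff]
    refine ⟨fun _ => 1, fun h => one_ne_zero (congrFun h hm.some), funext fun i => ?_⟩
    simp [L, Matrix.mulVec, dotProduct]
  obtain ⟨u, hu, hu0⟩ := hL
  have hbal (j : Fin m) : ∑ i, u i * b i j = u j * ∑ k, b j k := by
    have := congrFun hu0 j
    simp only [L, Matrix.vecMul, dotProduct, mul_sub, Finset.sum_sub_distrib, mul_ite, mul_zero,
      Finset.sum_ite_eq', Finset.mem_univ, if_true, Pi.zero_apply] at this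
    linarith
  have hle : ∀ j ∈ univ, |u j| * ∑ k, b j k ≤ ∑ i, |u i| * b i j := by
    intro j _
    have h0 : 0 ≤ ∑ k, b j k := sum_nonneg fun k _ => hb.nonneg j k
    calc |u j| * ∑ k, b j k = |∑ i, u i * b i j| := by rw [hbal, abs_mul, abs_of_nonneg h0]
      _ ≤ ∑ i, |u i * b i j| := abs_sum_le_sum_abs _ _
      _ = ∑ i, |u i| * b i j := by simp only [abs_mul, abs_of_nonneg (hb.nonneg _ j)]
  have hsum : ∑ j, |u j| * ∑ k, b j k = ∑ j, ∑ i, |u i| * b i j := by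
    rw [sum_comm]; simp only [mul_sum]
  have heq := (sum_eq_sum_iff_of_le hle).1 hsum
  obtain ⟨i₀, hi₀⟩ := Function.ne_iff.1 hu
  refine ⟨fun i => |u i|, fun i => ?_, fun j => ?_⟩
  · refine hG.forall_of_edge (P := fun i => 0 < |u i|) (fun i j hij hi => ?_) (abs_pos.2 hi₀) i
    have h1 : 0 < ∑ i, |u i| * b i j :=
      sum_pos' (fun k _ => mul_nonneg (abs_nonneg _) (hb.nonneg k j))
        ⟨i, mem_univ _, mul_pos hi ((hb i j).1 hij)⟩
    rw [← heq j (mem_univ j)] at h1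
    exact (abs_nonneg _).lt_of_ne fun h => by simp [← h] at h1
  · rw [← mul_sum]
    exact (heq j (mem_univ j)).symm

lemma GPrice_spec (hG : GConnected G) {b : Fin m → Fin m → ℝ} (hb : GPos G b) :
    GPriceProp b (GPrice b) := by
  have h := exists_price hG hb
  rw [GPrice, dif_pos h]
  exact h.choose_spec

/-- Some market state of a connected graph makes all prices equal. -/
lemma exists_GPrice_const (hG : GConnected G) :
    ∃ b, GPos G b ∧ ∀ i j, GPrice b i = GPrice b j := by
  let b₀ : Fin m → Fin m → ℝ := fun i j => if G i j then 1 else 0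
  have hb₀ : GPos G b₀ := fun i j => ⟨fun h => by simp [b₀, h], fun h => by simp [b₀, h]⟩
  obtain ⟨q, hq, hbal⟩ := exists_price hG hb₀
  let b : Fin m → Fin m → ℝ := fun i j => q i * b₀ i j
  have hb : GPos G b := fun i j =>
    ⟨fun h => mul_pos (hq i) ((hb₀ i j).1 h), fun h => by simp [b, (hb₀ i j).2 h]⟩
  refine ⟨b, hb, fun i j => ?_⟩
  obtain ⟨-, hp⟩ := GPrice_spec hG hb
  set p := GPrice b
  have : Nonempty (Fin m) := ⟨i⟩
  obtain ⟨z, hz⟩ := Finite.exists_min p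
  have hconst : ∀ i, p i = p z := by
    by_contra! hne
    obtain ⟨y, hy⟩ := hne
    refine (hG.forall_of_edge (P := fun i => p i ≠ p z) (fun i j hij hi hj => ?_) hy z) rfl
    have h1 : ∑ k, (p k - p j) * b k j = 0 := by
      simp only [sub_mul, sum_sub_distrib, hp j, ← mul_sum]
      rw [show ∑ k, b k j = ∑ k, b j k from hbal j, sub_self]
    have h2 := (sum_eq_zero_iff_of_nonneg fun k _ =>
      mul_nonneg (sub_nonneg.2 (hj ▸ hz k)) (hb.nonneg k j)).1 h1 i (mem_univ i)
    rcases mul_eq_zero.1 h2 with h | h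
    · exact hi (by linarith)
    · exact ((hb i j).1 hij).ne' h
  rw [hconst i, hconst j]

end Prices

section Time

variable {m : ℕ} {G : Fin m → Fin m → Prop}

lemma GConverts.of_edge (hG : GConnected G) {i j : Fin m} (hij : G i j) :
    GConverts G (Pi.single i 1) (Pi.single j 1) := by
  obtain ⟨b, hb, hc⟩ := exists_GPrice_const hG
  have hagg : GAgg (Pi.single i (Pi.single j (1 : ℝ))) = Pi.single i 1 := by
    ext k
    rcases eq_or_ne k i with rfl | h
    · simp [GAgg]
    · simp [GAgg, h]
  refine ⟨Pi.single i (Pi.single j 1), b, fun k l => ?_, hb, hagg.le, ?_⟩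
  · rcases eq_or_ne k i with rfl | hk
    · rcases eq_or_ne l j with rfl | hl
      · simp [hij]
      · simp [hl]
    · simp [hk]
  · have hp := (GPrice_spec hG hb).1
    have hret : GRet (Pi.single i (Pi.single j (1 : ℝ))) b = Pi.single j 1 := by
      ext k
      rw [GRet, sum_eq_single i (fun l _ hl => by simp [hl]) (by simp), Pi.single_eq_same, hc k i]
      rcases eq_or_ne k j with rfl | h
      · simp [(hp i).ne']
      · simp [h]
    ext k
    simp [GNu, hagg, hret]

lemma GConvertsIn.one {v w : Fin m → ℝ} (h : GConverts G v w) : GConvertsIn G 1 v w :=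
  ⟨![v, w], rfl, rfl, fun k => by fin_cases k; exact h⟩

lemma GConvertsIn.tail {t : ℕ} {u v w : Fin m → ℝ} (h : GConvertsIn G t u v)
    (h' : GConverts G v w) : GConvertsIn G (t + 1) u w := by
  obtain ⟨f, h0, h1, hf⟩ := h
  refine ⟨Fin.snoc f w, ?_, Fin.snoc_last _ _, fun k => ?_⟩
  · rw [← Fin.castSucc_zero, Fin.snoc_castSucc, h0]
  · refine Fin.lastCases ?_ (fun k => ?_) k
    · rw [Fin.succ_last, Fin.snoc_last, Fin.snoc_castSucc, h1]
      exact h'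
    · rw [Fin.snoc_castSucc, Fin.succ_castSucc, Fin.snoc_castSucc]
      exact hf k

lemma GTau_spec (hG : GConnected G) {i j : Fin m} (hij : i ≠ j) :
    GConvertsIn G (GTau G i j) (Pi.single i 1) (Pi.single j 1) := by
  refine Nat.sInf_mem (s := {t | GConvertsIn G t (Pi.single i 1) (Pi.single j 1)}) ?_
  have h := hG i j hij
  clear hij
  induction h with
  | single h => exact ⟨1, .one (.of_edge hG h)⟩
  | tail _ h ih =>
    obtain ⟨t, ht⟩ := ih
    exact ⟨t + 1, ht.tail (.of_edge hG h)⟩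

lemma GTau_le_one (hG : GConnected G) {i j : Fin m} (hij : G i j) : GTau G i j ≤ 1 :=
  Nat.sInf_le (.one (.of_edge hG hij))

/-- Conversion steps only move value along edges. -/
lemma GConverts.support {v w : Fin m → ℝ} (h : GConverts G v w) {j : Fin m} (hj : w j ≠ 0) :
    v j ≠ 0 ∨ ∃ i, v i ≠ 0 ∧ G i j := by
  obtain ⟨a, b, ha, -, hav, rfl⟩ := h
  by_contra! hcon
  obtain ⟨h0, hno⟩ := hcon
  have hrow (i : Fin m) (hi : v i = 0) (k : Fin m) : a i k = 0 := by
    have h1 : ∑ k, a i k = 0 :=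
      le_antisymm (hi ▸ hav i) (sum_nonneg fun k _ => (ha i k).1)
    exact (sum_eq_zero_iff_of_nonneg fun k _ => (ha i k).1).1 h1 k (mem_univ k)
  have hcol (i : Fin m) : a i j = 0 := by
    by_cases hi : v i = 0
    · exact hrow i hi j
    · exact (ha i j).2 (hno i hi)
  apply hj
  simp [GNu, GRet, GAgg, hcol, hrow j h0, h0]

lemma GTau_ne_zero (hG : GConnected G) {i j : Fin m} (hij : i ≠ j) : GTau G i j ≠ 0 := by
  intro h0
  have h := GTau_spec hG hij
  rw [h0] at h
  obtain ⟨f, h0, h1, -⟩ := h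
  have h2 := congrFun (h0.symm.trans h1) i
  simp [hij] at h2

lemma edge_of_GTau_le_one (hG : GConnected G) {i j : Fin m} (hij : i ≠ j)
    (h : GTau G i j ≤ 1) : G i j := by
  have hs := GTau_spec hG hij
  rw [show GTau G i j = 1 by have := GTau_ne_zero hG hij; omega] at hs
  obtain ⟨f, h0, h1, hf⟩ := hs
  have hc : GConverts G (Pi.single i 1) (Pi.single j 1) := by
    rw [← h0, ← h1]; exact hf 0
  rcases hc.support (j := j) (by simp) with h | ⟨k, hk, hkj⟩
  · simp [hij.symm] at h
  · obtain rfl : k = i := by by_contra hne; simp [hne] at hk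
    exact hkj

lemma edge_or_edges_of_GTau_le_two (hG : GConnected G) {i j : Fin m} (hij : i ≠ j)
    (h : GTau G i j ≤ 2) : G i j ∨ ∃ k, G i k ∧ G k j := by
  by_cases h1 : GTau G i j ≤ 1
  · exact .inl (edge_of_GTau_le_one hG hij h1)
  have hs := GTau_spec hG hij
  rw [show GTau G i j = 2 by omega] at hs
  obtain ⟨f, h0, h1, hf⟩ := hs
  have hc : GConverts G (Pi.single i 1) (f 1) := by rw [← h0]; exact hf 0
  have hc' : GConverts G (f 1) (Pi.single j 1) := by rw [← h1]; exact hf 1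
  have key (k : Fin m) (hk : f 1 k ≠ 0) : k = i ∨ G i k := by
    rcases hc.support hk with h | ⟨l, hl, hlk⟩
    · left; by_contra hne; simp [hne] at h
    · obtain rfl : l = i := by by_contra hne; simp [hne] at hl
      exact .inr hlk
  rcases hc'.support (j := j) (by simp) with h | ⟨k, hk, hkj⟩
  · exact .inl ((key j h).resolve_left hij.symm)
  · rcases key k hk with rfl | h
    · exact .inl hkj
    · exact .inr ⟨k, h, hkj⟩

end Time

section Influence

variable {m : ℕ} {G : Fin m → Fin m → Prop}

lemma sum_mul_balance (θ u : Fin m → ℝ) (b : Fin m → Fin m → ℝ) :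
    ∑ v, θ v * (∑ x, u x * b x v - u v * ∑ x, b v x) =
      ∑ x, u x * ∑ y, b x y * (θ y - θ x) := by
  simp only [mul_sub, sum_sub_distrib, mul_sum]
  rw [sum_comm]
  congr 1 <;> exact sum_congr rfl fun _ _ => sum_congr rfl fun _ _ => by ring

/-- An edge whose ends lie in different trees of a spanning forest oriented towards its two
roots `i` and `j` influences the price ratio of `i` and `j`. -/
lemma influential_of_spanning_forest (hG : GConnected G) {i j k l : Fin m} (hkl : G k l)
    {S : Finset (Fin m)} {ψ : Fin m → ℕ}
    (hψ : ∀ x, x ≠ i → x ≠ j → ∃ y, G x y ∧ ψ y < ψ x ∧ (y ∈ S ↔ x ∈ S))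
    (hS : ¬ (k ∈ S ↔ l ∈ S)) : GInfluential G i j (k, l) := by
  have hψ' : ∀ x, ∃ y, x ≠ i → x ≠ j → G x y ∧ ψ y < ψ x ∧ (y ∈ S ↔ x ∈ S) := fun x => by
    by_cases h : x ≠ i ∧ x ≠ j
    · obtain ⟨y, hy⟩ := hψ x h.1 h.2
      exact ⟨y, fun _ _ => hy⟩
    · exact ⟨x, fun h1 h2 => (h ⟨h1, h2⟩).elim⟩
  choose f hf using hψ'
  obtain ⟨M, hM⟩ : ∃ M : ℕ, ∀ x, ψ x ≤ M :=
    ⟨∑ x, ψ x, fun x => single_le_sum (f := ψ) (fun _ _ => Nat.zero_le _) (mem_univ x)⟩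
  have hM' : ∀ x, (ψ x : ℝ) ≤ M := fun x => by exact_mod_cast hM x
  obtain ⟨ε, hε, hεM, hεm⟩ : ∃ ε : ℝ, 0 < ε ∧ ε * m * M ≤ 1 / 2 ∧ ε * m * (4 * M) < 1 := by
    refine ⟨1 / (8 * (m + 1) * (M + 1)), by positivity, ?_, ?_⟩
    · rw [div_mul_eq_mul_div, div_mul_eq_mul_div, div_le_div_iff₀ (by positivity) (by positivity)]
      nlinarith [show (m * M : ℝ) ≥ 0 by positivity, show (m : ℝ) ≥ 0 by positivity,
        show (M : ℝ) ≥ 0 by positivity]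
    · rw [div_mul_eq_mul_div, div_mul_eq_mul_div, div_lt_one (by positivity)]
      nlinarith [show (m * M : ℝ) ≥ 0 by positivity, show (m : ℝ) ≥ 0 by positivity,
        show (M : ℝ) ≥ 0 by positivity]
  let b : Fin m → Fin m → ℝ := fun x y => if G x y then (if y = f x then 1 else ε) else 0
  have hb : GPos G b := fun x y => by
    refine ⟨fun h => ?_, fun h => by simp [b, h]⟩
    simp only [b, h, if_true]
    split_ifs
    exacts [one_pos, hε]
  have hb_le : ∀ x y, y ≠ f x → b x y ≤ ε := fun x y hy => by
    by_cases h : G x y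
    · simp [b, h, hy]
    · simp [b, h, hε.le]
  let b' : Fin m → Fin m → ℝ := fun x y => b x y + if x = k ∧ y = l then 1 else 0
  have hb' : GPos G b' := fun x y => by
    refine ⟨fun h => ?_, fun h => ?_⟩
    · have := (hb x y).1 h
      simp only [b']
      split_ifs <;> linarith
    · have hne : ¬ (x = k ∧ y = l) := by rintro ⟨rfl, rfl⟩; exact h hkl
      simp [b', hne, (hb x y).2 h]
  refine ⟨b, b', hb, hb', fun x y hxy => ?_, fun hratio => ?_⟩
  · have hne : ¬ (x = k ∧ y = l) := fun h => hxy (Prod.ext h.1 h.2)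
    simp [b', hne]
  obtain ⟨hp, hpb⟩ := GPrice_spec hG hb
  obtain ⟨hp', hpb'⟩ := GPrice_spec hG hb'
  set p := GPrice b
  set p' := GPrice b'
  let s := p j / p' j
  have hs : 0 < s := div_pos (hp j) (hp' j)
  let u : Fin m → ℝ := fun x => s * p' x - p x
  let c := s * p' k
  have hc : 0 < c := mul_pos hs (hp' k)
  have huj : u j = 0 := by simp [u, s, (hp' j).ne']
  have hui : u i = 0 := by
    rw [div_eq_div_iff (hp j).ne' (hp' j).ne'] at hratio
    simp only [u, s]
    rw [div_mul_eq_mul_div, sub_eq_zero, div_eq_iff (hp' j).ne']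
    linarith
  have hu (v : Fin m) : ∑ x, u x * b x v - u v * ∑ x, b v x =
      c * ((if v = k then 1 else 0) - if v = l then 1 else 0) := by
    have e1 := hpb v
    have e2 := hpb' v
    have e3 : ∑ x, p' x * b' x v = ∑ x, p' x * b x v + p' k * if v = l then 1 else 0 := by
      simp only [b', mul_add, sum_add_distrib, ite_and]
      simp
    have e4 : ∑ x, p' v * b' v x = p' v * ∑ x, b v x + p' k * if v = k then 1 else 0 := by
      simp only [b', mul_add, sum_add_distrib, mul_sum]
      congr 1
      by_cases h : v = k
      · subst h; simp
      · simp [h]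
    rw [← mul_sum] at e1
    rw [e3, e4] at e2
    simp only [u, c, sub_mul, sum_sub_distrib, mul_assoc, ← mul_sum]
    linear_combination s * e2 - e1
  have hsum : ∑ x, |u x| ≤ c * (4 * M) := by
    have h1 : ∑ v, (ψ v : ℝ) * (∑ x, |u x| * b x v - |u v| * ∑ x, b v x) ≥
        ∑ v, (ψ v : ℝ) * (- (c * ((if v = k then 1 else 0) + if v = l then 1 else 0))) := by
      refine sum_le_sum fun v _ => mul_le_mul_of_nonneg_left ?_ (Nat.cast_nonneg _)
      have h0 : 0 ≤ ∑ x, b v x := sum_nonneg fun x _ => hb.nonneg v x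
      have h2 : |u v| * ∑ x, b v x ≤ ∑ x, |u x| * b x v +
          c * ((if v = k then 1 else 0) + if v = l then 1 else 0) := by
        calc |u v| * ∑ x, b v x = |u v * ∑ x, b v x| := by rw [abs_mul, abs_of_nonneg h0]
          _ = |∑ x, u x * b x v -
              c * ((if v = k then 1 else 0) - if v = l then 1 else 0)| := by rw [← hu v]; ring_nf
          _ ≤ |∑ x, u x * b x v| +
              |c * ((if v = k then 1 else 0) - if v = l then 1 else 0)| := abs_sub _ _
          _ ≤ _ := by
            refine add_le_add ((abs_sum_le_sum_abs _ _).trans_eq ?_) ?_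
            · simp only [abs_mul, abs_of_nonneg (hb.nonneg _ v)]
            · rw [abs_mul, abs_of_pos hc]
              refine mul_le_mul_of_nonneg_left ?_ hc.le
              split_ifs <;> norm_num
      linarith
    have h2 : ∑ v, (ψ v : ℝ) * (- (c * ((if v = k then 1 else 0) + if v = l then 1 else 0))) =
        - (c * (ψ k + ψ l)) := by
      simp [mul_add, sum_add_distrib]
      ring
    rw [sum_mul_balance, h2] at h1
    have h3 : ∑ x, |u x| * ∑ y, b x y * ((ψ y : ℝ) - ψ x) ≤ ∑ x, |u x| * (-(1 / 2)) := by
      refine sum_le_sum fun x _ => ?_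
      rcases eq_or_ne x i with rfl | hxi
      · simp [hui]
      rcases eq_or_ne x j with rfl | hxj
      · simp [huj]
      refine mul_le_mul_of_nonneg_left ?_ (abs_nonneg _)
      obtain ⟨hx1, hx2, -⟩ := hf x hxi hxj
      have hx3 : (ψ (f x) : ℝ) + 1 ≤ ψ x := by exact_mod_cast hx2
      have h4 : ∑ y, b x y * ((ψ y : ℝ) - ψ x) ≤
          ∑ y, (ε * M + if y = f x then (-1 : ℝ) else 0) := by
        refine sum_le_sum fun y _ => ?_
        have hεM0 : 0 ≤ ε * M := by positivity
        by_cases hy : y = f x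
        · subst hy
          simp only [b, hx1, if_true]
          linarith
        · simp only [hy, if_false, add_zero]
          have h5 : (ψ y : ℝ) - ψ x ≤ M := by
            have := hM' y
            have : (0 : ℝ) ≤ ψ x := Nat.cast_nonneg _
            linarith
          calc b x y * ((ψ y : ℝ) - ψ x) ≤ b x y * M :=
                mul_le_mul_of_nonneg_left h5 (hb.nonneg x y)
            _ ≤ ε * M := mul_le_mul_of_nonneg_right (hb_le x y hy) (Nat.cast_nonneg _)
      refine h4.trans ?_
      simp only [sum_add_distrib, sum_const, card_univ, Fintype.card_fin, sum_ite_eq', mem_univ,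
        if_true, nsmul_eq_mul]
      linarith
    rw [← sum_mul] at h3
    have h6 : c * (ψ k + ψ l) ≤ c * (2 * M) :=
      mul_le_mul_of_nonneg_left (by linarith [hM' k, hM' l]) hc.le
    linarith
  let φ : Fin m → ℝ := fun x => if x ∈ S then 1 else 0
  have hφ : ∀ x y, |φ y - φ x| ≤ 1 := fun x y => by
    simp only [φ]; split_ifs <;> norm_num
  have h1 := sum_mul_balance φ u b
  have h2 : |∑ v, φ v * (∑ x, u x * b x v - u v * ∑ x, b v x)| = c := by
    have h3 : ∑ v, φ v * (∑ x, u x * b x v - u v * ∑ x, b v x) = c * (φ k - φ l) := by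
      simp only [hu, mul_sub, sum_sub_distrib]
      simp [mul_comm]
    rw [h3, abs_mul, abs_of_pos hc]
    by_cases hk : k ∈ S <;> by_cases hl : l ∈ S <;> simp_all [φ]
  have h3 : |∑ x, u x * ∑ y, b x y * (φ y - φ x)| ≤ ∑ x, |u x| * (ε * m) := by
    refine (abs_sum_le_sum_abs _ _).trans (sum_le_sum fun x _ => ?_)
    rw [abs_mul]
    rcases eq_or_ne x i with rfl | hxi
    · simp [hui]
    rcases eq_or_ne x j with rfl | hxj
    · simp [huj]
    refine mul_le_mul_of_nonneg_left ?_ (abs_nonneg _)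
    calc |∑ y, b x y * (φ y - φ x)| ≤ ∑ y, |b x y * (φ y - φ x)| := abs_sum_le_sum_abs _ _
      _ ≤ ∑ _y : Fin m, ε := sum_le_sum fun y _ => by
          by_cases hy : y = f x
          · simp [φ, hy, (hf x hxi hxj).2.2, hε.le]
          · rw [abs_mul, abs_of_nonneg (hb.nonneg x y)]
            calc b x y * |φ y - φ x| ≤ b x y * 1 :=
                  mul_le_mul_of_nonneg_left (hφ x y) (hb.nonneg x y)
              _ ≤ ε := by rw [mul_one]; exact hb_le x y hy
      _ = ε * m := by simp [mul_comm]
  rw [← h1, h2, ← sum_mul] at h3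
  have h4 : (∑ x, |u x|) * (ε * m) ≤ c * (4 * M) * (ε * m) :=
    mul_le_mul_of_nonneg_right hsum (by positivity)
  nlinarith

/-- Disjoint vertex sets `A ∋ i` and `B ∋ j`, each spanned by a tree oriented towards its root. -/
def IsForest (G : Fin m → Fin m → Prop) (i j : Fin m) (A B : Finset (Fin m)) : Prop :=
  Disjoint A B ∧ ∃ ψ : Fin m → ℕ,
    (∀ x ∈ A, x ≠ i → ∃ y ∈ A, G x y ∧ ψ y < ψ x) ∧ ∀ x ∈ B, x ≠ j → ∃ y ∈ B, G x y ∧ ψ y < ψ x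

lemma IsForest.symm {i j : Fin m} {A B : Finset (Fin m)} (h : IsForest G i j A B) :
    IsForest G j i B A := by
  obtain ⟨hd, ψ, h1, h2⟩ := h
  exact ⟨hd.symm, ψ, h2, h1⟩

lemma isForest_roots {i j : Fin m} (hij : i ≠ j) : IsForest G i j {i} {j} :=
  ⟨by simpa using hij, 0, by simp, by simp⟩

lemma IsForest.insert_left {i j x w : Fin m} {A B : Finset (Fin m)} (h : IsForest G i j A B)
    (hx : x ∉ B) (hw : w ∈ A) (hxw : G x w) : IsForest G i j (insert x A) B := by
  by_cases hxA : x ∈ A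
  · rwa [insert_eq_of_mem hxA]
  obtain ⟨hd, ψ, h1, h2⟩ := h
  refine ⟨by simp [hx, hd], Function.update ψ x (ψ w + 1), fun y hy hyi => ?_, fun y hy hyj => ?_⟩
  · rcases mem_insert.1 hy with rfl | hyA
    · refine ⟨w, mem_insert_of_mem hw, hxw, ?_⟩
      have : w ≠ y := by rintro rfl; exact hxA hw
      simp [this]
    · obtain ⟨z, hz, hyz, hlt⟩ := h1 y hyA hyi
      have hy' : y ≠ x := by rintro rfl; exact hxA hyA
      have hz' : z ≠ x := by rintro rfl; exact hxA hz
      exact ⟨z, mem_insert_of_mem hz, hyz, by simpa [hy', hz'] using hlt⟩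
  · obtain ⟨z, hz, hyz, hlt⟩ := h2 y hy hyj
    have hy' : y ≠ x := by rintro rfl; exact hx hy
    have hz' : z ≠ x := by rintro rfl; exact hx hz
    exact ⟨z, hz, hyz, by simpa [hy', hz'] using hlt⟩

/-- In a connected graph every nonempty forest extends to a spanning one. -/
lemma IsForest.exists_spanning (hG : GConnected G) {i j : Fin m} {A B : Finset (Fin m)}
    (h : IsForest G i j A B) (hi : i ∈ A) :
    ∃ A' B', IsForest G i j A' B' ∧ A ⊆ A' ∧ B ⊆ B' ∧ ∀ x, x ∈ A' ∨ x ∈ B' := by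
  induction hn : #(A ∪ B)ᶜ using Nat.strong_induction_on generalizing A B with
  | _ n ih =>
    by_cases hall : ∀ x, x ∈ A ∨ x ∈ B
    · exact ⟨A, B, h, subset_rfl, subset_rfl, hall⟩
    obtain ⟨x, w, hx, hw, hxw⟩ : ∃ x w, ¬ (x ∈ A ∨ x ∈ B) ∧ (w ∈ A ∨ w ∈ B) ∧ G x w := by
      by_contra! hcon
      obtain ⟨x, hx⟩ := not_forall.1 hall
      exact hG.forall_of_edge (P := fun x => ¬ (x ∈ A ∨ x ∈ B))
        (fun y z hyz hy hz => hcon y z (not_or.1 hy) hz hyz) hx i (.inl hi)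
    have hlt (C : Finset (Fin m)) (hC : C = insert x (A ∪ B)) : #Cᶜ < n := by
      rw [← hn, hC]
      refine card_lt_card (compl_ssubset_compl.2 (ssubset_insert (by simpa using hx)))
    rw [not_or] at hx
    rcases hw with hw | hw
    · obtain ⟨A', B', h1, h2, h3, h4⟩ := ih _ (hlt (insert x A ∪ B) (insert_union _ _ _))
        (h.insert_left hx.2 hw hxw) (mem_insert_of_mem hi) rfl
      exact ⟨A', B', h1, (subset_insert _ _).trans h2, h3, h4⟩
    · obtain ⟨A', B', h1, h2, h3, h4⟩ := ih _ (hlt (A ∪ insert x B) (union_insert _ _ _))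
        (h.symm.insert_left hx.1 hw hxw).symm hi rfl
      exact ⟨A', B', h1, h2, (subset_insert _ _).trans h3, h4⟩

lemma IsForest.influential (hG : GConnected G) {i j k l : Fin m} {A B : Finset (Fin m)}
    (h : IsForest G i j A B) (hi : i ∈ A) (hkl : G k l)
    (hAB : k ∈ A ∧ l ∈ B ∨ l ∈ A ∧ k ∈ B) : GInfluential G i j (k, l) := by
  obtain ⟨A', B', ⟨hd, ψ, h1, h2⟩, hA, hB, hall⟩ := h.exists_spanning hG hi
  have hB' {x : Fin m} (hx : x ∈ B') : x ∉ A' := disjoint_right.1 hd hx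
  refine influential_of_spanning_forest hG hkl (S := A') (ψ := ψ) (fun x hxi hxj => ?_) ?_
  · rcases hall x with hx | hx
    · obtain ⟨y, hy, hxy, hlt⟩ := h1 x hx hxi
      exact ⟨y, hxy, hlt, by simp [hy, hx]⟩
    · obtain ⟨y, hy, hxy, hlt⟩ := h2 x hx hxj
      exact ⟨y, hxy, hlt, by simp [hB' hy, hB' hx]⟩
  · rcases hAB with ⟨hk, hl⟩ | ⟨hl, hk⟩
    · simp [hA hk, hB' (hB hl)]
    · simp [hA hl, hB' (hB hk)]

/-- A path from `k` to `i` that avoids the forest's second tree can be added to its first tree. -/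
lemma IsForest.of_isChain {i j : Fin m} {B : Finset (Fin m)} {P : List (Fin m)}
    (hB : IsForest G i j {i} B) (hP : (P ++ [i]).IsChain G) (hd : ∀ x ∈ P, x ∉ B) :
    IsForest G i j (P ++ [i]).toFinset B := by
  induction P with
  | nil => simpa using hB
  | cons x P ih =>
    have ih' := ih (List.IsChain.tail hP) fun y hy => hd y (List.mem_cons_of_mem _ hy)
    rw [List.cons_append, List.toFinset_cons]
    obtain ⟨w, T, hw⟩ : ∃ w T, P ++ [i] = w :: T := List.exists_cons_of_ne_nil (by simp)
    rw [hw] at ih' ⊢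
    rw [List.cons_append, hw] at hP
    exact ih'.insert_left (hd x List.mem_cons_self) (by simp) (List.isChain_cons_cons.1 hP).1

/-- An edge `kl` is influential for the price ratio of `i` and `j` if there are disjoint paths
joining `{k, l}` to `{i, j}`. -/
lemma influential_of_paths (hG : GConnected G) {i j k l : Fin m} (P Q : List (Fin m))
    (hkl : G k l) (hP : (P ++ [i]).IsChain G) (hQ : (Q ++ [j]).IsChain G)
    (hd : ∀ x ∈ P ++ [i], x ∉ Q ++ [j])
    (hends : k ∈ P ++ [i] ∧ l ∈ Q ++ [j] ∨ l ∈ P ++ [i] ∧ k ∈ Q ++ [j]) :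
    GInfluential G i j (k, l) := by
  have hij : i ≠ j := fun h => hd i (by simp) (by simp [h])
  have hQ' : IsForest G i j {i} (Q ++ [j]).toFinset :=
    ((isForest_roots hij).symm.of_isChain hQ fun x hx hxi =>
      hd i (by simp) (by simp_all)).symm
  refine (hQ'.of_isChain hP fun x hx hxQ => ?_).influential hG (by simp) hkl
    (by simpa only [List.mem_toFinset] using hends)
  exact hd x (List.mem_append_left _ hx) (List.mem_toFinset.1 hxQ)

lemma five_le_GPi {i j : Fin m} (L : List (Fin m × Fin m)) (hL : ∀ e ∈ L, GInfluential G i j e)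
    (hnd : L.Nodup) (h5 : L.length = 5) : 5 ≤ GPi G i j := by
  rw [← h5, ← List.toFinset_card_of_nodup hnd, ← Set.ncard_coe_finset]
  exact Set.ncard_le_ncard (fun e he => hL e (by simpa using he)) (Set.toFinite _)

end Influence

section Graphs

variable {m : ℕ} {G : Fin m → Fin m → Prop}

lemma GraphIso.of_iff {G' : Fin m → Fin m → Prop} (h : ∀ i j, G i j ↔ G' i j) : GraphIso G G' :=
  ⟨Equiv.refl _, h⟩

lemma GIrrefl.ne (hG : GIrrefl G) {i j : Fin m} (h : G i j) : i ≠ j ∧ j ≠ i := by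
  constructor <;> rintro rfl <;> exact hG _ h

/-- Every vertex of `G` is at distance at most two from every other one. -/
def HasDiamTwo (G : Fin m → Fin m → Prop) : Prop :=
  ∀ i j, i ≠ j → G i j ∨ ∃ k, G i k ∧ G k j

/-- Some price ratio has at least five influential components. -/
def HasFiveInfluences (G : Fin m → Fin m → Prop) : Prop := ∃ i j, i ≠ j ∧ 5 ≤ GPi G i j

lemma HasFiveInfluences.of_edges {i j : Fin m} (hij : i ≠ j) (e₁ e₂ e₃ e₄ e₅ : Fin m × Fin m)
    (hnd : [e₁, e₂, e₃, e₄, e₅].Nodup) (h₁ : GInfluential G i j e₁) (h₂ : GInfluential G i j e₂)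
    (h₃ : GInfluential G i j e₃) (h₄ : GInfluential G i j e₄) (h₅ : GInfluential G i j e₅) :
    HasFiveInfluences G :=
  ⟨i, j, hij, five_le_GPi _ (by simp [*]) hnd rfl⟩

/-- A triangle with two reversed edges. -/
lemma HasFiveInfluences.of_triangle_two_back (hG : GOK G) {a b c : Fin m} (hab : G a b)
    (hba : G b a) (hbc : G b c) (hcb : G c b) (hca : G c a) : HasFiveInfluences G := by
  have := hG.1.ne hab; have := hG.1.ne hbc; have := hG.1.ne hca
  refine .of_edges (i := a) (j := b) (hG.1.ne hab).1 (a, b) (b, a) (b, c) (c, b) (c, a)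
    ?_ (influential_of_paths hG.2 [] [] hab ?_ ?_ ?_ ?_)
    (influential_of_paths hG.2 [] [] hba ?_ ?_ ?_ ?_)
    (influential_of_paths hG.2 [c] [] hbc ?_ ?_ ?_ ?_)
    (influential_of_paths hG.2 [c] [] hcb ?_ ?_ ?_ ?_)
    (influential_of_paths hG.2 [] [c] hca ?_ ?_ ?_ ?_) <;> simp_all

/-- A triangle `a → b → c → a` with a detour `a → d → b`. -/
lemma HasFiveInfluences.of_triangle_chord (hG : GOK G) (hD : HasDiamTwo G) {a b c d : Fin m}
    (hab : G a b) (hbc : G b c) (hca : G c a) (had : G a d) (hdb : G d b) (hdc : d ≠ c) :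
    HasFiveInfluences G := by
  have := hG.1.ne hab; have := hG.1.ne hbc; have := hG.1.ne hca
  have := hG.1.ne had; have := hG.1.ne hdb; have := hdc.symm
  have i₁ : GInfluential G b d (a, b) := by
    refine influential_of_paths hG.2 [] [a] hab ?_ ?_ ?_ ?_ <;> simp_all
  have i₂ : GInfluential G b d (a, d) := by
    refine influential_of_paths hG.2 [a] [] had ?_ ?_ ?_ ?_ <;> simp_all
  have i₃ : GInfluential G b d (d, b) := by
    refine influential_of_paths hG.2 [] [] hdb ?_ ?_ ?_ ?_ <;> simp_all
  have i₄ : GInfluential G b d (b, c) := by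
    refine influential_of_paths hG.2 [] [c, a] hbc ?_ ?_ ?_ ?_ <;> simp_all
  suffices h : ∃ x y, (x = d ∧ y ≠ b ∨ x = b ∧ y = a) ∧ GInfluential G b d (x, y) by
    obtain ⟨x, y, hxy, i₅⟩ := h
    refine .of_edges (hG.1.ne hdb).2 _ _ _ _ _ ?_ i₁ i₂ i₃ i₄ i₅
    rcases hxy with ⟨rfl, _⟩ | ⟨rfl, rfl⟩ <;> simp_all [eq_comm]
  rcases hD d a (by tauto) with hda | ⟨z, hdz, hza⟩
  · refine ⟨d, a, by simp_all, influential_of_paths hG.2 [a] [] hda ?_ ?_ ?_ ?_⟩ <;> simp_all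
  have := hG.1.ne hdz; have := hG.1.ne hza
  by_cases hzb : z = b
  · subst hzb
    refine ⟨z, a, by simp, influential_of_paths hG.2 [] [a] hza ?_ ?_ ?_ ?_⟩ <;> simp_all
  · refine ⟨d, z, by simp_all, influential_of_paths hG.2 [z, a] [] hdz ?_ ?_ ?_ ?_⟩ <;> simp_all

/-- Two triangles `a → b → c → a` and `a → d → c → a`. -/
lemma HasFiveInfluences.of_two_triangles (hG : GOK G) (hD : HasDiamTwo G) {a b c d : Fin m}
    (hab : G a b) (hbc : G b c) (hca : G c a) (had : G a d) (hdc : G d c) (hdb : d ≠ b) :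
    HasFiveInfluences G := by
  have := hG.1.ne hab; have := hG.1.ne hbc; have := hG.1.ne hca
  have := hG.1.ne had; have := hG.1.ne hdc; have := hdb.symm
  have i₁ : GInfluential G b d (a, b) := by
    refine influential_of_paths hG.2 [] [a] hab ?_ ?_ ?_ ?_ <;> simp_all
  have i₂ : GInfluential G b d (a, d) := by
    refine influential_of_paths hG.2 [a] [] had ?_ ?_ ?_ ?_ <;> simp_all
  have i₃ : GInfluential G b d (b, c) := by
    refine influential_of_paths hG.2 [] [c, a] hbc ?_ ?_ ?_ ?_ <;> simp_all
  have i₄ : GInfluential G b d (d, c) := by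
    refine influential_of_paths hG.2 [c, a] [] hdc ?_ ?_ ?_ ?_ <;> simp_all
  suffices h : ∃ x y, (x = b ∧ y ≠ c ∨ x = c) ∧ GInfluential G b d (x, y) by
    obtain ⟨x, y, hxy, i₅⟩ := h
    refine .of_edges hdb.symm _ _ _ _ _ ?_ i₁ i₂ i₃ i₄ i₅
    rcases hxy with ⟨rfl, _⟩ | rfl <;> simp_all [eq_comm]
  rcases hD b d hdb.symm with hbd | ⟨z, hbz, hzd⟩
  · refine ⟨b, d, by simp_all, influential_of_paths hG.2 [] [] hbd ?_ ?_ ?_ ?_⟩ <;> simp_all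
  have := hG.1.ne hbz; have := hG.1.ne hzd
  by_cases hzc : z = c
  · subst hzc
    refine ⟨z, d, by simp, influential_of_paths hG.2 [z, a] [] hzd ?_ ?_ ?_ ?_⟩ <;> simp_all
  · refine ⟨b, z, by simp_all, influential_of_paths hG.2 [] [z] hbz ?_ ?_ ?_ ?_⟩ <;> simp_all

/-- A triangle `a → b → c → a` with edges `a → d → a`. -/
lemma HasFiveInfluences.of_triangle_digon (hG : GOK G) (hD : HasDiamTwo G) {a b c d : Fin m}
    (hab : G a b) (hbc : G b c) (hca : G c a) (had : G a d) (hda : G d a) (hdb : d ≠ b)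
    (hdc : d ≠ c) : HasFiveInfluences G := by
  have := hG.1.ne hab; have := hG.1.ne hbc; have := hG.1.ne hca
  have := hG.1.ne had; have := hdb.symm; have := hdc.symm
  by_cases hbd : G b d
  · exact .of_two_triangles hG hD hbc hca hab hbd hda hdc
  by_cases hcd : G c d
  · exact .of_triangle_chord hG hD hca hab hbc hcd hda hdb
  by_cases hdc' : G d c
  · exact .of_two_triangles hG hD hab hbc hca had hdc' hdb
  by_cases hdb' : G d b
  · exact .of_triangle_chord hG hD hab hbc hca had hdb' hdc
  obtain ⟨x, hbx, hxd⟩ := (hD b d hdb.symm).resolve_left hbd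
  obtain ⟨y, hdy, hyc⟩ := (hD d c hdc).resolve_left hdc'
  have := hG.1.ne hbx; have := hG.1.ne hxd
  have := hG.1.ne hdy; have := hG.1.ne hyc
  have hxc : x ≠ c ∧ c ≠ x := by constructor <;> rintro rfl <;> exact hcd hxd
  have hyb : y ≠ b ∧ b ≠ y := by constructor <;> rintro rfl <;> exact hdb' hdy
  by_cases hxa : x = a
  · subst hxa
    by_cases hya : y = x
    · subst hya
      exact .of_triangle_two_back hG hca hyc hab hbx hbc
    · have := Ne.symm hya
      refine .of_edges (i := x) (j := c) (by tauto) (x, b) (c, x) (x, d) (d, x) (d, y)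
        ?_ (influential_of_paths hG.2 [] [b] hab ?_ ?_ ?_ ?_)
        (influential_of_paths hG.2 [] [] hca ?_ ?_ ?_ ?_)
        (influential_of_paths hG.2 [] [d, y] had ?_ ?_ ?_ ?_)
        (influential_of_paths hG.2 [] [d, y] hda ?_ ?_ ?_ ?_)
        (influential_of_paths hG.2 [d] [y] hdy ?_ ?_ ?_ ?_) <;> simp_all
  · have := Ne.symm hxa
    refine .of_edges (i := a) (j := d) (by tauto) (a, d) (d, a) (b, x) (b, c) (a, b)
      ?_ (influential_of_paths hG.2 [] [] had ?_ ?_ ?_ ?_)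
      (influential_of_paths hG.2 [] [] hda ?_ ?_ ?_ ?_)
      (influential_of_paths hG.2 [b, c] [x] hbx ?_ ?_ ?_ ?_)
      (influential_of_paths hG.2 [c] [b, x] hbc ?_ ?_ ?_ ?_)
      (influential_of_paths hG.2 [] [b, x] hab ?_ ?_ ?_ ?_) <;> simp_all

/-- A triangle and a vertex outside it joined in both directions to the triangle. -/
lemma HasFiveInfluences.of_triangle_ear (hG : GOK G) (hD : HasDiamTwo G) {a b c d t : Fin m}
    (hab : G a b) (hbc : G b c) (hca : G c a) (had : G a d) (hdt : G d t) (hdb : d ≠ b)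
    (hdc : d ≠ c) (ht : t = a ∨ t = b ∨ t = c) : HasFiveInfluences G := by
  rcases ht with rfl | rfl | rfl
  · exact .of_triangle_digon hG hD hab hbc hca had hdt hdb hdc
  · exact .of_triangle_chord hG hD hab hbc hca had hdt hdc
  · exact .of_two_triangles hG hD hab hbc hca had hdt hdb

/-- A triangle with an edge leaving it. -/
lemma HasFiveInfluences.of_triangle_out (hG : GOK G) (hD : HasDiamTwo G) {a b c d : Fin m}
    (hab : G a b) (hbc : G b c) (hca : G c a) (had : G a d) (hdb : d ≠ b) (hdc : d ≠ c) :
    HasFiveInfluences G := by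
  by_cases hdt : ∃ t, G d t ∧ (t = a ∨ t = b ∨ t = c)
  · obtain ⟨t, hdt, ht⟩ := hdt
    exact .of_triangle_ear hG hD hab hbc hca had hdt hdb hdc ht
  push Not at hdt
  have := hG.1.ne hab; have := hG.1.ne hbc; have := hG.1.ne hca
  have := hG.1.ne had; have := hdb.symm; have := hdc.symm
  obtain ⟨x, hdx, hxb⟩ := (hD d b hdb).resolve_left fun h => (hdt b h).2.1 rfl
  obtain ⟨y, hdy, hyc⟩ := (hD d c hdc).resolve_left fun h => (hdt c h).2.2 rfl
  obtain ⟨hxa, hxb', hxc⟩ := hdt x hdx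
  obtain ⟨hya, hyb, hyc'⟩ := hdt y hdy
  have := hG.1.ne hdx; have := hG.1.ne hdy
  have := hxa.symm; have := hxb'.symm; have := hxc.symm
  have := hya.symm; have := hyb.symm; have := hyc'.symm
  have i₁ : GInfluential G b c (b, c) := by
    refine influential_of_paths hG.2 [] [] hbc ?_ ?_ ?_ ?_ <;> simp_all
  have i₂ : GInfluential G b c (a, b) := by
    refine influential_of_paths hG.2 [] [a, d, y] hab ?_ ?_ ?_ ?_ <;> simp_all
  have i₃ : GInfluential G b c (a, d) := by
    refine influential_of_paths hG.2 [a] [d, y] had ?_ ?_ ?_ ?_ <;> simp_all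
  by_cases hxy : x = y
  · subst hxy
    refine .of_edges (hG.1.ne hbc).1 _ _ _ (x, b) (x, c) ?_ i₁ i₂ i₃
      (influential_of_paths hG.2 [] [x] hxb ?_ ?_ ?_ ?_)
      (influential_of_paths hG.2 [x] [] hyc ?_ ?_ ?_ ?_) <;> simp_all
  · have := Ne.symm hxy
    refine .of_edges (hG.1.ne hbc).1 _ _ _ (d, x) (d, y) ?_ i₁ i₂ i₃
      (influential_of_paths hG.2 [x] [d, y] hdx ?_ ?_ ?_ ?_)
      (influential_of_paths hG.2 [d, x] [y] hdy ?_ ?_ ?_ ?_) <;> simp_all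

lemma HasFiveInfluences.of_triangle (hm : 3 < m) (hG : GOK G) (hD : HasDiamTwo G)
    {a b c : Fin m} (hab : G a b) (hbc : G b c) (hca : G c a) : HasFiveInfluences G := by
  obtain ⟨t, d, ht, htd, hda, hdb, hdc⟩ : ∃ t d, (t = a ∨ t = b ∨ t = c) ∧ G t d ∧
      d ≠ a ∧ d ≠ b ∧ d ≠ c := by
    by_contra! hcon
    have hall : ∀ x, x = a ∨ x = b ∨ x = c :=
      hG.2.forall_of_edge (fun x y hxy hx => by have := hcon x y hx hxy; tauto) (.inl rfl)
    have h1 : #(univ : Finset (Fin m)) ≤ #({a, b, c} : Finset (Fin m)) :=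
      card_le_card fun x _ => by simpa using hall x
    have h2 := card_le_three (a := a) (b := b) (c := c)
    simp only [card_univ, Fintype.card_fin] at h1
    omega
  rcases ht with rfl | rfl | rfl
  · exact .of_triangle_out hG hD hab hbc hca htd hdb hdc
  · exact .of_triangle_out hG hD hbc hca hab htd hdc hda
  · exact .of_triangle_out hG hD hca hab hbc htd hda hdb

/-- A connected graph of diameter two all of whose edges are reversible is a star or has a price
ratio with five influential components. -/
lemma HasFiveInfluences.of_symmetric (hm : 3 < m) (hG : GOK G) (hD : HasDiamTwo G)
    (hsymm : ∀ i j, G i j → G j i) (hstar : ∀ c, ¬ GraphIso G (starGraph m c)) :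
    HasFiveInfluences G := by
  by_cases htri : ∃ a b c, G a b ∧ G b c ∧ G c a
  · obtain ⟨a, b, c, hab, hbc, hca⟩ := htri
    exact .of_triangle hm hG hD hab hbc hca
  push Not at htri
  obtain ⟨c, y₁, y₂, hy, hc₁, hc₂⟩ : ∃ c y₁ y₂, y₁ ≠ y₂ ∧ G c y₁ ∧ G c y₂ := by
    let i : Fin m := ⟨0, by omega⟩
    let j : Fin m := ⟨1, by omega⟩
    let k : Fin m := ⟨2, by omega⟩
    have hij : i ≠ j := by simp [i, j]
    have hik : i ≠ k := by simp [i, k]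
    have hjk : j ≠ k := by simp [j, k]
    rcases hD i j hij with h | ⟨z, hiz, hzj⟩
    · rcases hD i k hik with h' | ⟨z, hiz, hzk⟩
      · exact ⟨i, j, k, hjk, h, h'⟩
      · exact ⟨z, i, k, hik, hsymm _ _ hiz, hzk⟩
    · exact ⟨z, i, j, hij, hsymm _ _ hiz, hzj⟩
  obtain ⟨x, hxc, hcx⟩ : ∃ x, x ≠ c ∧ ¬ G c x := by
    by_contra! hcon
    refine hstar c (.of_iff fun i j => ⟨fun h => ⟨(hG.1.ne h).1, ?_⟩, ?_⟩)
    · by_contra! hij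
      exact htri c i j (hcon i hij.1) h (hsymm _ _ (hcon j hij.2))
    · rintro ⟨hij, rfl | rfl⟩
      · exact hcon j hij.symm
      · exact hsymm _ _ (hcon i hij)
  obtain ⟨y, hcy, hyx⟩ := (hD c x hxc.symm).resolve_left hcx
  obtain ⟨z, hcz, hzy⟩ : ∃ z, G c z ∧ z ≠ y := by
    by_cases h : y₁ = y
    · exact ⟨y₂, hc₂, h ▸ hy.symm⟩
    · exact ⟨y₁, hc₁, h⟩
  have hyc := hsymm _ _ hcy
  have hzc := hsymm _ _ hcz
  have hxy := hsymm _ _ hyx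
  have hzx : z ≠ x := by rintro rfl; exact hcx hcz
  have := hG.1.ne hcy; have := hG.1.ne hyx; have := hG.1.ne hcz
  have := hzx.symm; have := hzy.symm; have := hxc.symm
  have i₁ : GInfluential G c y (c, y) := by
    refine influential_of_paths hG.2 [] [] hcy ?_ ?_ ?_ ?_ <;> simp_all
  have i₂ : GInfluential G c y (y, c) := by
    refine influential_of_paths hG.2 [] [] hyc ?_ ?_ ?_ ?_ <;> simp_all
  by_cases hzx' : G z x
  · have hxz := hsymm _ _ hzx'
    refine .of_edges (hG.1.ne hcy).1 _ _ (y, x) (x, y) (x, z) ?_ i₁ i₂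
      (influential_of_paths hG.2 [x, z] [] hyx ?_ ?_ ?_ ?_)
      (influential_of_paths hG.2 [x, z] [] hxy ?_ ?_ ?_ ?_)
      (influential_of_paths hG.2 [z] [x] hxz ?_ ?_ ?_ ?_) <;> simp_all
  · obtain ⟨w, hzw, hwx⟩ := (hD z x hzx).resolve_left hzx'
    have hwz := hsymm _ _ hzw
    have hxw := hsymm _ _ hwx
    have hwc : w ≠ c ∧ c ≠ w := by constructor <;> rintro rfl <;> exact hcx hwx
    have hwy : w ≠ y ∧ y ≠ w := by constructor <;> rintro rfl <;> exact htri c z _ hcz hzw hyc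
    have := hG.1.ne hzw; have := hG.1.ne hwx
    refine .of_edges (hG.1.ne hcy).1 _ _ (y, x) (x, y) (x, w) ?_ i₁ i₂
      (influential_of_paths hG.2 [x, w, z] [] hyx ?_ ?_ ?_ ?_)
      (influential_of_paths hG.2 [x, w, z] [] hxy ?_ ?_ ?_ ?_)
      (influential_of_paths hG.2 [w, z] [x] hxw ?_ ?_ ?_ ?_) <;> simp_all

lemma HasFiveInfluences.of_not_star (hm : 3 < m) (hG : GOK G) (hD : HasDiamTwo G)
    (hstar : ∀ c, ¬ GraphIso G (starGraph m c)) : HasFiveInfluences G := by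
  by_cases hsymm : ∀ i j, G i j → G j i
  · exact .of_symmetric hm hG hD hsymm hstar
  push Not at hsymm
  obtain ⟨a, b, hab, hba⟩ := hsymm
  obtain ⟨c, hbc, hca⟩ := (hD b a (hG.1.ne hab).2).resolve_left hba
  exact .of_triangle hm hG hD hab hbc hca

lemma gok_starGraph (c : Fin m) : GOK (starGraph m c) := by
  refine ⟨fun i h => h.1 rfl, fun i j hij => ?_⟩
  by_cases hi : i = c
  · exact .single ⟨hij, .inl hi⟩
  by_cases hj : j = c
  · exact .single ⟨hij, .inr hj⟩
  · exact .tail (.single ⟨hi, .inr rfl⟩) ⟨Ne.symm hj, .inl rfl⟩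

lemma gok_completeDigraph : GOK (completeDigraph m) :=
  ⟨fun _ h => h rfl, fun _ _ hij => .single hij⟩

lemma GKcx_cycleGraph (i : Fin m) : GKcx (cycleGraph m) i ≤ 1 := by
  refine (Set.ncard_le_one (Set.toFinite _)).2 fun a ha b hb => Fin.ext ?_
  exact Eq.trans ha (Eq.symm hb)

/-- A connected graph of out-degree at most one is a cycle. -/
lemma graphIso_cycleGraph_of_GKcx_le_one (hm : 3 < m) (hG : GOK G) (hk : ∀ i, GKcx G i ≤ 1) :
    GraphIso G (cycleGraph m) := by
  obtain ⟨n, rfl⟩ : ∃ n, m = n + 2 := ⟨m - 2, by omega⟩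
  have hout : ∀ i, ∃ j, G i j := fun i => by
    obtain ⟨j, hj⟩ := exists_ne i
    obtain ⟨k, hk, -⟩ := Relation.TransGen.head'_iff.1 (hG.2 i j hj.symm)
    exact ⟨k, hk⟩
  choose f hf using hout
  have hGf : ∀ i j, G i j ↔ f i = j := fun i j =>
    ⟨fun h => (Set.ncard_le_one (Set.toFinite _)).1 (hk i) _ (hf i) _ h, fun h => h ▸ hf i⟩
  have hsurj : Function.Surjective f := fun j => by
    obtain ⟨i, hi⟩ := exists_ne j
    obtain ⟨k, -, hk⟩ := Relation.TransGen.tail'_iff.1 (hG.2 i j hi)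
    exact ⟨k, (hGf k j).1 hk⟩
  let e : Equiv.Perm (Fin (n + 2)) := Equiv.ofBijective f (Finite.surjective_iff_bijective.1 hsurj)
  have hef : ∀ i, e i = f i := fun _ => rfl
  have hne : ∀ i, e i ≠ i := fun i => (hG.1.ne (hf i)).2
  have hcyc : e.IsCycle := by
    refine ⟨0, hne 0, fun y _ => ?_⟩
    exact hG.2.forall_of_edge (P := fun y => e.SameCycle 0 y)
      (fun i j hij hi => by rw [← (hGf i j).1 hij, ← hef]; exact hi.apply_right) (.refl _ _) y
  have hsupp : e.support = univ := by ext i; simpa using hne i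
  obtain ⟨σ, hσ⟩ := isConj_iff.1 ((hcyc.isConj_iff isCycle_finRotate).2
    (by rw [hsupp, support_finRotate]))
  refine ⟨σ, fun i j => ?_⟩
  have h1 : finRotate (n + 2) (σ i) = σ (e i) := by rw [← hσ]; simp
  have h2 : cycleGraph (n + 2) (σ i) (σ j) ↔ σ j = finRotate (n + 2) (σ i) := by
    rw [cycleGraph, finRotate_apply, Fin.ext_iff, Fin.val_add]
    simp
  rw [h2, h1, σ.apply_eq_iff_eq, hGf, hef, eq_comm]

end Graphs

/-- Minimality of the three special mechanisms in `𝔐_g(m)`.  For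
`m > 3`, each of the star, cycle and complete mechanisms is `⪯`-minimal in `𝔐_g(m)`: no
`G`-mechanism `M′` satisfies `M′ ⪯ M` and `M′ ≠ M` (up to relabeling) for `M` one of these
three.  In particular: any `G`-mechanism whose graph is not complete has some `τ_ij > 1`;
any `G`-mechanism whose graph is not the cycle has some `k_i > 1`; and any `G`-mechanism
whose graph is not a star has either some `π_ij ≥ 5` or some `τ_ij ≥ 3`. -/
theorem special_mechanisms_minimal {m : ℕ} (hm : 3 < m) :
    (∀ c : Fin m, ∀ G' : Fin m → Fin m → Prop, GOK G' →
      GLe G' (starGraph m c) → GraphIso G' (starGraph m c)) ∧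
    (∀ G' : Fin m → Fin m → Prop, GOK G' →
      GLe G' (cycleGraph m) → GraphIso G' (cycleGraph m)) ∧
    (∀ G' : Fin m → Fin m → Prop, GOK G' →
      GLe G' (completeDigraph m) → GraphIso G' (completeDigraph m)) ∧
    (∀ G : Fin m → Fin m → Prop, GOK G → ¬ GraphIso G (completeDigraph m) →
      ∃ i j : Fin m, i ≠ j ∧ 1 < GTau G i j) ∧
    (∀ G : Fin m → Fin m → Prop, GOK G → ¬ GraphIso G (cycleGraph m) →
      ∃ i : Fin m, 1 < GKcx G i) ∧
    (∀ G : Fin m → Fin m → Prop, GOK G → (∀ c : Fin m, ¬ GraphIso G (starGraph m c)) →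
      (∃ i j : Fin m, i ≠ j ∧ 5 ≤ GPi G i j) ∨ (∃ i j : Fin m, i ≠ j ∧ 3 ≤ GTau G i j)) := by
  have hcomplete (G : Fin m → Fin m → Prop) (hG : GOK G)
      (h : ∀ i j, i ≠ j → GTau G i j ≤ 1) : GraphIso G (completeDigraph m) :=
    .of_iff fun i j => ⟨fun h => (hG.1.ne h).1, fun hij => edge_of_GTau_le_one hG.2 hij (h i j hij)⟩
  refine ⟨fun c G' hG' hle => ?_, fun G' hG' hle => ?_, fun G' hG' hle => ?_, fun G hG hne => ?_,
    fun G hG hne => ?_, fun G hG hne => ?_⟩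
  · have hsub {i j : Fin m} (hij : starGraph m c i j) : G' i j :=
      edge_of_GTau_le_one hG'.2 hij.1
        ((hle.1 i j hij.1).1.trans (GTau_le_one (gok_starGraph c).2 hij))
    have heq (i : Fin m) : {j | starGraph m c i j} = {j | G' i j} :=
      Set.eq_of_subset_of_ncard_le (fun j hj => hsub hj) (hle.2 i) (Set.toFinite _)
    exact .of_iff fun i j => (Set.ext_iff.1 (heq i) j).symm
  · exact graphIso_cycleGraph_of_GKcx_le_one hm hG' fun i => (hle.2 i).trans (GKcx_cycleGraph i)
  · exact hcomplete G' hG' fun i j hij =>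
      (hle.1 i j hij).1.trans (GTau_le_one gok_completeDigraph.2 hij)
  · by_contra! hcon
    exact hne (hcomplete G hG hcon)
  · by_contra! hcon
    exact hne (graphIso_cycleGraph_of_GKcx_le_one hm hG hcon)
  · by_contra! hcon
    obtain ⟨hπ, hτ⟩ := hcon
    obtain ⟨i, j, hij, h⟩ := HasFiveInfluences.of_not_star hm hG
      (fun i j hij => edge_or_edges_of_GTau_le_two hG.2 hij (Nat.le_of_lt_succ (hτ i j hij))) hne
    exact (hπ i j hij).not_ge h
end
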